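/- A closed (compact without boundary) smooth Levi-flat hypersurface M in CP^n, n ≥ 2, cannot be globally defined by a pluriharmonic function: there is no pluriharmonic function ρ with nonvanishing gradient on a neighbourhood of M in CP^n such that M = ρ^{-1}(0). -/

import Mathlib

/- STATEMENT 10: A closed smooth Levi-flat hypersurface M in ℂℙⁿ, n ≥ 2, cannot be
globally defined by a pluriharmonic function: there is no pluriharmonic function ρ with
nonvanishing gradient on a neighbourhood of M in ℂℙⁿ with M = ρ⁻¹(0).

Subsets of ℂℙⁿ and functions on them are encoded by cones in ℂ^{n+1} ∖ {0} and
scaling-invariant functions on them.  A (C²) function is pluriharmonic iff its full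
complex Hessian `∂∂̄ρ` vanishes, i.e. `leviForm ρ z w = 0` for all directions `w`. -/

open Complex Set

noncomputable section

/-- The Levi form (up to a positive factor) of the defining function `ρ` at `p`,
evaluated at `w`: `D²ρ(p)(w,w) + D²ρ(p)(Jw,Jw) = 4 ∑ ∂²ρ/∂zⱼ∂z̄ₖ wⱼ w̄ₖ`. -/
def leviForm {m : ℕ} (ρ : (Fin m → ℂ) → ℝ) (p w : Fin m → ℂ) : ℝ :=
  iteratedFDeriv ℝ 2 ρ p ![w, w] + iteratedFDeriv ℝ 2 ρ p ![Complex.I • w, Complex.I • w]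

/-- `w` belongs to the complex tangent space at `p` of the hypersurface `{ρ = 0}`. -/
def IsComplexTangent {m : ℕ} (ρ : (Fin m → ℂ) → ℝ) (p w : Fin m → ℂ) : Prop :=
  fderiv ℝ ρ p w = 0 ∧ fderiv ℝ ρ p (Complex.I • w) = 0

/-- `M` is a smooth (`C^∞`) Levi-flat real hypersurface: near each of its points it is
the zero set of a smooth defining function with nonvanishing gradient whose Levi form
vanishes identically on complex tangent vectors. -/
def IsSmoothLeviFlatHypersurface {m : ℕ} (M : Set (Fin m → ℂ)) : Prop :=
  ∀ p ∈ M, ∃ V : Set (Fin m → ℂ), IsOpen V ∧ p ∈ V ∧ ∃ ρ : (Fin m → ℂ) → ℝ,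
    (∀ k : ℕ, ContDiffOn ℝ k ρ V) ∧ (∀ q ∈ V, fderiv ℝ ρ q ≠ 0) ∧
    (∀ q ∈ V, q ∈ M ↔ ρ q = 0) ∧
    (∀ q ∈ V, ρ q = 0 → ∀ w, IsComplexTangent ρ q w → leviForm ρ q w = 0)

/-- `S` is a cone: it is invariant under multiplication by nonzero complex scalars.
Subsets of `ℂℙⁿ` are encoded by the cones over them in `ℂ^{n+1} ∖ {0}`. -/
def IsCone {m : ℕ} (S : Set (Fin m → ℂ)) : Prop :=
  ∀ c : ℂ, c ≠ 0 → ∀ z ∈ S, c • z ∈ S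

/-- The cone `S ⊆ ℂ^{n+1} ∖ {0}` represents a closed (= compact) subset of `ℂℙⁿ`:
it is closed in the punctured space `ℂ^{n+1} ∖ {0}`. -/
def IsClosedInPunctured {m : ℕ} (S : Set (Fin m → ℂ)) : Prop :=
  ∀ z ∈ closure S, z ≠ 0 → z ∈ S

/-- The cone over a closed subset of `ℂℙⁿ`. -/
def IsProjectiveClosedSet {m : ℕ} (S : Set (Fin m → ℂ)) : Prop :=
  S.Nonempty ∧ (∀ z ∈ S, z ≠ 0) ∧ IsCone S ∧ IsClosedInPunctured S

open Filter Topology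

/-- Second-order Taylor expansion with Peano remainder. -/
theorem ContDiffAt.taylor_two_isLittleO {E : Type*} [NormedAddCommGroup E] [NormedSpace ℝ E]
    {g : E → ℝ} {x : E} (hg : ContDiffAt ℝ 2 g x) :
    (fun h => g (x + h) - g x - fderiv ℝ g x h - fderiv ℝ (fderiv ℝ g) x h h / 2)
      =o[𝓝 0] fun h => ‖h‖ ^ 2 := by
  have hdiff : ∀ᶠ y in 𝓝 x, DifferentiableAt ℝ g y := by
    filter_upwards [hg.eventually (by simp)] with y hy
    exact hy.differentiableAt (by simp)
  have hd2 : HasFDerivAt (fderiv ℝ g) (fderiv ℝ (fderiv ℝ g) x) x :=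
    ((hg.fderiv_right (m := 1) (by norm_num)).differentiableAt (by simp)).hasFDerivAt
  have hsymm : ∀ u v, fderiv ℝ (fderiv ℝ g) x u v = fderiv ℝ (fderiv ℝ g) x v u :=
    fun u v => (hg.isSymmSndFDerivAt (by simp)).eq u v
  set D := fderiv ℝ (fderiv ℝ g) x
  rw [Asymptotics.isLittleO_iff]
  intro c hc
  have h1 := (hasFDerivAt_iff_isLittleO_nhds_zero.1 hd2).def hc
  have h2 : ∀ᶠ h in 𝓝 (0 : E), DifferentiableAt ℝ g (x + h) := by
    have : Tendsto (fun h : E => x + h) (𝓝 0) (𝓝 x) := by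
      have hc : Continuous fun h : E => x + h := by fun_prop
      simpa using hc.tendsto 0
    exact this.eventually hdiff
  obtain ⟨r, hr, hball⟩ := Metric.eventually_nhds_iff_ball.1 (h1.and h2)
  filter_upwards [Metric.ball_mem_nhds (0 : E) hr] with h hh
  have hh' : ‖h‖ < r := by simpa using hh
  have key := (convex_closedBall (0 : E) ‖h‖).norm_image_sub_le_of_norm_hasFDerivWithin_le
    (f := fun h => g (x + h) - g x - fderiv ℝ g x h - D h h / 2)
    (f' := fun h => fderiv ℝ g (x + h) - fderiv ℝ g x - D h) (C := c * ‖h‖) (x := 0) (y := h)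
    (fun u hu => by
      have hu' : u ∈ Metric.ball (0 : E) r := by
        simp only [Metric.mem_closedBall, dist_zero_right, Metric.mem_ball] at hu ⊢
        linarith
      have e1 : HasFDerivAt (fun h => g (x + h)) (fderiv ℝ g (x + u)) u := by
        exact (hasFDerivAt_comp_add_left x).2 (hball u hu').2.hasFDerivAt
      have e2 : HasFDerivAt (fun h => D h h / 2) (D u) u := by
        have := (D.hasFDerivAt (x := u)).clm_apply (hasFDerivAt_id u)
        refine (this.const_mul (1 / 2 : ℝ)).congr_fderiv ?_ |>.congr_of_eventuallyEq
          (Eventually.of_forall fun v => ?_)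
        · ext v
          simp [hsymm v u]
          ring
        · simp only [id_eq]
          ring
      exact (((e1.sub_const _).sub (fderiv ℝ g x).hasFDerivAt).sub e2).hasFDerivWithinAt)
    (fun u hu => by
      have hu0 : ‖u‖ ≤ ‖h‖ := by simpa using hu
      have hu' : u ∈ Metric.ball (0 : E) r := by
        simp only [Metric.mem_ball, dist_zero_right]; linarith
      exact (hball u hu').1.trans (by gcongr))
    (by simp) (by simp)
  simpa [pow_two, mul_assoc] using key

/-- Along a direction `a` tangent to a level set, the level set contains points
`x + s a + s² e ν` with `e` tending to `-D²g(a, a) / 2` as `s → 0`. -/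
theorem eventually_exists_mem_levelSet {E : Type*} [NormedAddCommGroup E] [NormedSpace ℝ E]
    {g : E → ℝ} {x a ν : E} (hg : ContDiffAt ℝ 2 g x) (ha : fderiv ℝ g x a = 0)
    (hν : fderiv ℝ g x ν = 1) {U : Set ℝ}
    (hU : U ∈ 𝓝 (-(fderiv ℝ (fderiv ℝ g) x a a / 2))) :
    ∀ᶠ s : ℝ in 𝓝[>] 0, ∃ e ∈ U, g (x + (s • a + (s ^ 2 * e) • ν)) = g x := by
  set D := fderiv ℝ (fderiv ℝ g) x
  set k := -(D a a / 2) with hk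
  have hlim : ∀ e : ℝ, Tendsto (fun s : ℝ => (g (x + (s • a + (s ^ 2 * e) • ν)) - g x) / s ^ 2)
      (𝓝[>] 0) (𝓝 (e - k)) := by
    intro e
    have hc : Tendsto (fun s : ℝ => s • a + (s ^ 2 * e) • ν) (𝓝[>] 0) (𝓝 0) := by
      have : Continuous fun s : ℝ => s • a + (s ^ 2 * e) • ν := by fun_prop
      simpa using (this.tendsto 0).mono_left nhdsWithin_le_nhds
    have ho := hg.taylor_two_isLittleO.comp_tendsto hc
    have hO : (fun s : ℝ => ‖s • a + (s ^ 2 * e) • ν‖ ^ 2) =O[𝓝[>] 0] fun s : ℝ => s ^ 2 := by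
      have : (fun s : ℝ => s • (a + (s * e) • ν)) =O[𝓝[>] 0] fun s : ℝ => s • (1 : ℝ) := by
        refine (Asymptotics.isBigO_refl _ _).smul ?_
        have hc : Continuous fun s : ℝ => a + (s * e) • ν := by fun_prop
        exact ((hc.tendsto 0).mono_left nhdsWithin_le_nhds).isBigO_one ℝ
      refine ((this.norm_left).pow 2).congr (fun s => ?_) (fun s => by simp)
      rw [smul_add, smul_smul, ← mul_assoc, ← pow_two]
    have ht := (ho.trans_isBigO hO).tendsto_div_nhds_zero
    have hq : Tendsto (fun s : ℝ => e + D (a + (s * e) • ν) (a + (s * e) • ν) / 2)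
        (𝓝[>] 0) (𝓝 (e - k)) := by
      have : Continuous fun s : ℝ => e + D (a + (s * e) • ν) (a + (s * e) • ν) / 2 := by fun_prop
      have h := (this.tendsto 0).mono_left (nhdsWithin_le_nhds (s := Ioi 0))
      simpa [hk] using h
    have hs := ht.add hq
    rw [zero_add] at hs
    refine hs.congr' ?_
    filter_upwards [self_mem_nhdsWithin] with s hs
    have hs0 : s ≠ 0 := ne_of_gt hs
    have hsm : s • a + (s ^ 2 * e) • ν = s • (a + (s * e) • ν) := by
      rw [smul_add, smul_smul, ← mul_assoc, ← pow_two]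
    simp only [Function.comp_apply]
    have hd : fderiv ℝ g x (s • a + (s ^ 2 * e) • ν) = s ^ 2 * e := by simp [ha, hν]
    rw [hd, hsm]
    simp only [map_smul, smul_apply, smul_eq_mul]
    field_simp
    ring
  have hcont : ∀ᶠ p : ℝ × ℝ in 𝓝 (0, k), ContinuousAt g (x + (p.1 • a + (p.1 ^ 2 * p.2) • ν)) := by
    have : Continuous fun p : ℝ × ℝ => x + (p.1 • a + (p.1 ^ 2 * p.2) • ν) := by fun_prop
    have h := this.tendsto (0, k)
    simp only [zero_smul, ne_eq, OfNat.ofNat_ne_zero, not_false_eq_true, zero_pow, zero_mul,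
      add_zero] at h
    refine h.eventually ?_
    filter_upwards [hg.eventually (by simp)] with y hy
    exact hy.continuousAt
  rw [nhds_prod_eq] at hcont
  obtain ⟨P, hP, Q, hQ, hPQ⟩ := Filter.eventually_prod_iff.1 hcont
  obtain ⟨r, hr, hball⟩ := Metric.mem_nhds_iff.1 (Filter.inter_mem hU hQ)
  have hsub : Icc (k - r / 2) (k + r / 2) ⊆ Metric.ball k r := by
    intro e he
    rw [Metric.mem_ball, Real.dist_eq, abs_lt]
    constructor <;> linarith [he.1, he.2]
  have hlo := (hlim (k - r / 2)).eventually (eventually_lt_nhds (b := 0) (by linarith))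
  have hhi := (hlim (k + r / 2)).eventually (eventually_gt_nhds (b := 0) (by linarith))
  filter_upwards [hlo, hhi, nhdsWithin_le_nhds hP, self_mem_nhdsWithin] with s hs1 hs2 hs3 hs4
  have hs2pos : 0 < s ^ 2 := pow_pos hs4 2
  have hco : ContinuousOn (fun e : ℝ => g (x + (s • a + (s ^ 2 * e) • ν)))
      (Icc (k - r / 2) (k + r / 2)) := by
    intro e he
    have h1 : ContinuousAt g (x + (s • a + (s ^ 2 * e) • ν)) := hPQ hs3 (hball (hsub he)).2
    have h2 : ContinuousAt (fun e : ℝ => x + (s • a + (s ^ 2 * e) • ν)) e := by fun_prop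
    exact (ContinuousAt.comp (f := fun e : ℝ => x + (s • a + (s ^ 2 * e) • ν)) h1
      h2).continuousWithinAt
  rw [div_lt_iff₀ hs2pos] at hs1
  rw [lt_div_iff₀ hs2pos] at hs2
  obtain ⟨e, he, hge⟩ := intermediate_value_Icc (by linarith) hco
    (show g x ∈ Icc _ _ from ⟨by linarith, by linarith⟩)
  exact ⟨e, (hball (hsub he)).1, hge⟩

/-- The real part of the standard Hermitian product on `ℂᵐ`. -/
def rePairing {m : ℕ} (z w : Fin m → ℂ) : ℝ :=
  ∑ i, ((z i).re * (w i).re + (z i).im * (w i).im)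

section rePairing

variable {m : ℕ}

theorem rePairing_comm (z w : Fin m → ℂ) : rePairing z w = rePairing w z := by
  simp only [rePairing, mul_comm]

theorem rePairing_add_left (z z' w : Fin m → ℂ) :
    rePairing (z + z') w = rePairing z w + rePairing z' w := by
  simp only [rePairing, ← Finset.sum_add_distrib]
  refine Finset.sum_congr rfl fun i _ => ?_
  simp
  ring

theorem rePairing_add_right (z w w' : Fin m → ℂ) :
    rePairing z (w + w') = rePairing z w + rePairing z w' := by
  rw [rePairing_comm, rePairing_add_left, rePairing_comm w, rePairing_comm w']

theorem rePairing_smul_left (r : ℝ) (z w : Fin m → ℂ) :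
    rePairing (r • z) w = r * rePairing z w := by
  simp only [rePairing, Finset.mul_sum]
  refine Finset.sum_congr rfl fun i _ => ?_
  simp
  ring

theorem rePairing_smul_right (r : ℝ) (z w : Fin m → ℂ) :
    rePairing z (r • w) = r * rePairing z w := by
  rw [rePairing_comm, rePairing_smul_left, rePairing_comm]

theorem rePairing_I_smul (z w : Fin m → ℂ) :
    rePairing (Complex.I • z) (Complex.I • w) = rePairing z w := by
  simp only [rePairing]
  refine Finset.sum_congr rfl fun i _ => ?_
  simp
  ring

theorem rePairing_self_nonneg (z : Fin m → ℂ) : 0 ≤ rePairing z z :=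
  Finset.sum_nonneg fun _ _ => add_nonneg (mul_self_nonneg _) (mul_self_nonneg _)

theorem rePairing_self_eq_zero {z : Fin m → ℂ} : rePairing z z = 0 ↔ z = 0 := by
  refine ⟨fun h => funext fun i => ?_, fun h => by simp [h, rePairing]⟩
  have := (Finset.sum_eq_zero_iff_of_nonneg fun _ _ =>
    add_nonneg (mul_self_nonneg _) (mul_self_nonneg _)).1 h i (Finset.mem_univ i)
  apply Complex.ext <;> simp <;> nlinarith [mul_self_nonneg (z i).re, mul_self_nonneg (z i).im]

theorem rePairing_self_pos {z : Fin m → ℂ} (hz : z ≠ 0) : 0 < rePairing z z :=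
  (rePairing_self_nonneg z).lt_of_ne fun h => hz (rePairing_self_eq_zero.1 h.symm)

theorem continuous_rePairing :
    Continuous fun p : (Fin m → ℂ) × (Fin m → ℂ) => rePairing p.1 p.2 := by
  unfold rePairing
  fun_prop

theorem isCompact_rePairing_sphere : IsCompact {z : Fin m → ℂ | rePairing z z = 1} := by
  have hcont : Continuous fun z : Fin m → ℂ => rePairing z z :=
    continuous_rePairing.comp (continuous_id.prodMk continuous_id)
  refine Metric.isCompact_of_isClosed_isBounded (isClosed_eq hcont continuous_const)
    ((Metric.isBounded_closedBall (x := 0) (r := 1)).subset fun z hz => ?_)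
  rw [mem_closedBall_zero_iff, pi_norm_le_iff_of_nonneg zero_le_one]
  intro i
  have h1 : (z i).re * (z i).re + (z i).im * (z i).im ≤ rePairing z z :=
    Finset.single_le_sum (f := fun i => (z i).re * (z i).re + (z i).im * (z i).im)
      (fun _ _ => add_nonneg (mul_self_nonneg _) (mul_self_nonneg _)) (Finset.mem_univ i)
  rw [← sq_le_one_iff₀ (norm_nonneg _), Complex.sq_norm, Complex.normSq_apply]
  exact h1.trans hz.le

end rePairing

/-- Second-order necessary condition for `(x, y)` to maximize
`⟨z, w⟩ - c (⟨z, z⟩ + ⟨w, w⟩)` over a product of two level sets, in the diagonal direction `(a, a)`,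
which is tangent to both, provided that the first derivative in that direction is nonnegative. -/
theorem second_order_le_of_nonneg {m : ℕ} {g₁ g₂ : (Fin m → ℂ) → ℝ} {x y a ν₁ ν₂ : Fin m → ℂ}
    {c : ℝ} (hg₁ : ContDiffAt ℝ 2 g₁ x) (hg₂ : ContDiffAt ℝ 2 g₂ y)
    (ha₁ : fderiv ℝ g₁ x a = 0) (ha₂ : fderiv ℝ g₂ y a = 0)
    (hν₁ : fderiv ℝ g₁ x ν₁ = 1) (hν₂ : fderiv ℝ g₂ y ν₂ = 1)
    (hmax : ∀ᶠ p in 𝓝 (x, y), g₁ p.1 = g₁ x → g₂ p.2 = g₂ y →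
      rePairing p.1 p.2 ≤ c * (rePairing p.1 p.1 + rePairing p.2 p.2))
    (heq : rePairing x y = c * (rePairing x x + rePairing y y))
    (hL : 0 ≤ rePairing x a + rePairing y a - 2 * c * (rePairing x a + rePairing y a)) :
    (1 - 2 * c) * rePairing a a
      - fderiv ℝ (fderiv ℝ g₁) x a a / 2 * (rePairing ν₁ y - 2 * c * rePairing ν₁ x)
      - fderiv ℝ (fderiv ℝ g₂) y a a / 2 * (rePairing ν₂ x - 2 * c * rePairing ν₂ y) ≤ 0 := by
  by_contra! hpos
  set k₁ := -(fderiv ℝ (fderiv ℝ g₁) x a a / 2) with hk₁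
  set k₂ := -(fderiv ℝ (fderiv ℝ g₂) y a a / 2) with hk₂
  let H₁ : ℝ × ℝ × ℝ → (Fin m → ℂ) := fun q => q.1 • a + (q.1 ^ 2 * q.2.1) • ν₁
  let H₂ : ℝ × ℝ × ℝ → (Fin m → ℂ) := fun q => q.1 • a + (q.1 ^ 2 * q.2.2) • ν₂
  let R₁ : ℝ × ℝ × ℝ → (Fin m → ℂ) := fun q => a + (q.1 * q.2.1) • ν₁
  let R₂ : ℝ × ℝ × ℝ → (Fin m → ℂ) := fun q => a + (q.1 * q.2.2) • ν₂
  let Φ : ℝ × ℝ × ℝ → ℝ := fun q =>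
    rePairing (R₁ q) (R₂ q) - c * (rePairing (R₁ q) (R₁ q) + rePairing (R₂ q) (R₂ q))
      + q.2.1 * (rePairing ν₁ y - 2 * c * rePairing ν₁ x)
      + q.2.2 * (rePairing ν₂ x - 2 * c * rePairing ν₂ y)
  have hR₁ : Continuous R₁ := by fun_prop
  have hR₂ : Continuous R₂ := by fun_prop
  have hΦ : Continuous Φ := by
    have h12 := continuous_rePairing.comp (hR₁.prodMk hR₂)
    have h11 := continuous_rePairing.comp (hR₁.prodMk hR₁)
    have h22 := continuous_rePairing.comp (hR₂.prodMk hR₂)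
    exact (((h12.sub ((h11.add h22).const_mul c))).add (by fun_prop)).add (by fun_prop)
  have hΦ0 : 0 < Φ (0, k₁, k₂) := by
    simp only [Φ, R₁, R₂, zero_mul, zero_smul, add_zero]
    refine hpos.trans_eq ?_
    rw [hk₁, hk₂]
    ring
  have hpath : Continuous fun q => (x + H₁ q, y + H₂ q) := by fun_prop
  have hev := (hΦ.tendsto (0, k₁, k₂)).eventually (eventually_gt_nhds hΦ0)
  have hev2 : ∀ᶠ q in 𝓝 ((0, k₁, k₂) : ℝ × ℝ × ℝ), g₁ (x + H₁ q) = g₁ x → g₂ (y + H₂ q) = g₂ y →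
      rePairing (x + H₁ q) (y + H₂ q) ≤
        c * (rePairing (x + H₁ q) (x + H₁ q) + rePairing (y + H₂ q) (y + H₂ q)) := by
    have h := hpath.tendsto (0, k₁, k₂)
    simp only [H₁, H₂, zero_smul, ne_eq, OfNat.ofNat_ne_zero, not_false_eq_true, zero_pow,
      zero_mul, add_zero] at h
    exact h.eventually hmax
  have hboth := hev.and hev2
  rw [nhds_prod_eq, nhds_prod_eq] at hboth
  obtain ⟨P, hP, Q, hQ, hPQ⟩ := Filter.eventually_prod_iff.1 hboth
  obtain ⟨Q₁, hQ₁, Q₂, hQ₂, hQQ⟩ := Filter.eventually_prod_iff.1 hQ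
  have h1 := eventually_exists_mem_levelSet hg₁ ha₁ hν₁ (U := {e | Q₁ e}) hQ₁
  have h2 := eventually_exists_mem_levelSet hg₂ ha₂ hν₂ (U := {e | Q₂ e}) hQ₂
  have hP' : ∀ᶠ s in 𝓝[>] (0 : ℝ), P s := nhdsWithin_le_nhds hP
  obtain ⟨s, ⟨e₁, he₁, hs₁⟩, ⟨e₂, he₂, hs₂⟩, hPs, hs⟩ :=
    (h1.and (h2.and (hP'.and self_mem_nhdsWithin))).exists
  obtain ⟨hΦpos, hle⟩ := hPQ hPs (hQQ he₁ he₂)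
  have hle := hle hs₁ hs₂
  have hs : 0 < s := hs
  have key : rePairing (x + H₁ (s, e₁, e₂)) (y + H₂ (s, e₁, e₂)) -
        c * (rePairing (x + H₁ (s, e₁, e₂)) (x + H₁ (s, e₁, e₂)) +
          rePairing (y + H₂ (s, e₁, e₂)) (y + H₂ (s, e₁, e₂))) =
      (rePairing x y - c * (rePairing x x + rePairing y y)) +
      s * (rePairing x a + rePairing y a - 2 * c * (rePairing x a + rePairing y a)) +
      s ^ 2 * Φ (s, e₁, e₂) := by
    simp only [Φ, H₁, H₂, R₁, R₂, rePairing_add_left, rePairing_add_right, rePairing_smul_left,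
      rePairing_smul_right, rePairing_comm a x, rePairing_comm a y, rePairing_comm x ν₁,
      rePairing_comm x ν₂, rePairing_comm y ν₂, rePairing_comm ν₁ a,
      rePairing_comm ν₂ a]
    ring
  have := mul_pos (pow_pos hs 2) hΦpos
  have := mul_nonneg hs.le hL
  linarith

/-- Second-order necessary condition for `(x, y)` to maximize
`⟨z, w⟩ - c (⟨z, z⟩ + ⟨w, w⟩)` over a product of two level sets, in the diagonal direction `(a, a)`,
which is tangent to both. -/
theorem second_order_le {m : ℕ} {g₁ g₂ : (Fin m → ℂ) → ℝ} {x y a ν₁ ν₂ : Fin m → ℂ}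
    {c : ℝ} (hg₁ : ContDiffAt ℝ 2 g₁ x) (hg₂ : ContDiffAt ℝ 2 g₂ y)
    (ha₁ : fderiv ℝ g₁ x a = 0) (ha₂ : fderiv ℝ g₂ y a = 0)
    (hν₁ : fderiv ℝ g₁ x ν₁ = 1) (hν₂ : fderiv ℝ g₂ y ν₂ = 1)
    (hmax : ∀ᶠ p in 𝓝 (x, y), g₁ p.1 = g₁ x → g₂ p.2 = g₂ y →
      rePairing p.1 p.2 ≤ c * (rePairing p.1 p.1 + rePairing p.2 p.2))
    (heq : rePairing x y = c * (rePairing x x + rePairing y y)) :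
    (1 - 2 * c) * rePairing a a
      - fderiv ℝ (fderiv ℝ g₁) x a a / 2 * (rePairing ν₁ y - 2 * c * rePairing ν₁ x)
      - fderiv ℝ (fderiv ℝ g₂) y a a / 2 * (rePairing ν₂ x - 2 * c * rePairing ν₂ y) ≤ 0 := by
  rcases le_total 0 (rePairing x a + rePairing y a - 2 * c * (rePairing x a + rePairing y a))
    with h | h
  · exact second_order_le_of_nonneg hg₁ hg₂ ha₁ ha₂ hν₁ hν₂ hmax heq h
  · have hneg : ∀ u : Fin m → ℂ, rePairing u (-a) = -rePairing u a := fun u => by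
      simpa using rePairing_smul_right (-1) u a
    have hnn : rePairing (-a) (-a) = rePairing a a := by
      rw [hneg, rePairing_comm, hneg, neg_neg]
    have := second_order_le_of_nonneg (a := -a) hg₁ hg₂ (by simp [ha₁]) (by simp [ha₂]) hν₁ hν₂
      hmax heq (by rw [hneg, hneg]; linarith)
    simpa [hnn] using this

/-- Two level sets of functions with vanishing Levi form cannot contain a pair `(x, y)` maximizing
`⟨z, w⟩ - c (⟨z, z⟩ + ⟨w, w⟩)` with `c < 1 / 2`, in dimension at least three. -/
theorem half_le_of_leviForm_eq_zero {n : ℕ} (hn : 2 ≤ n) {g₁ g₂ : (Fin (n + 1) → ℂ) → ℝ}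
    {x y : Fin (n + 1) → ℂ} {c : ℝ} (hg₁ : ContDiffAt ℝ 2 g₁ x) (hg₂ : ContDiffAt ℝ 2 g₂ y)
    (hd₁ : fderiv ℝ g₁ x ≠ 0) (hd₂ : fderiv ℝ g₂ y ≠ 0)
    (hl₁ : ∀ w, leviForm g₁ x w = 0) (hl₂ : ∀ w, leviForm g₂ y w = 0)
    (hmax : ∀ᶠ p in 𝓝 (x, y), g₁ p.1 = g₁ x → g₂ p.2 = g₂ y →
      rePairing p.1 p.2 ≤ c * (rePairing p.1 p.1 + rePairing p.2 p.2))
    (heq : rePairing x y = c * (rePairing x x + rePairing y y)) : 1 ≤ 2 * c := by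
  have hν : ∀ L : (Fin (n + 1) → ℂ) →L[ℝ] ℝ, L ≠ 0 → ∃ ν, L ν = 1 := by
    intro L hL
    obtain ⟨v, hv⟩ := DFunLike.ne_iff.1 hL
    exact ⟨(L v)⁻¹ • v, by simpa using inv_mul_cancel₀ hv⟩
  obtain ⟨ν₁, hν₁⟩ := hν _ hd₁
  obtain ⟨ν₂, hν₂⟩ := hν _ hd₂
  let J : (Fin (n + 1) → ℂ) →ₗ[ℝ] (Fin (n + 1) → ℂ) :=
    (LinearMap.lsmul ℂ (Fin (n + 1) → ℂ) Complex.I).restrictScalars ℝ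
  let L₁ : (Fin (n + 1) → ℂ) →ₗ[ℝ] ℝ := (fderiv ℝ g₁ x : _ →ₗ[ℝ] ℝ)
  let L₂ : (Fin (n + 1) → ℂ) →ₗ[ℝ] ℝ := (fderiv ℝ g₂ y : _ →ₗ[ℝ] ℝ)
  let T : (Fin (n + 1) → ℂ) →ₗ[ℝ] (ℝ × ℝ) × (ℝ × ℝ) :=
    (L₁.prod (L₁ ∘ₗ J)).prod (L₂.prod (L₂ ∘ₗ J))
  have hrank : Module.finrank ℝ ((ℝ × ℝ) × (ℝ × ℝ)) < Module.finrank ℝ (Fin (n + 1) → ℂ) := by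
    simp only [Module.finrank_prod, Module.finrank_self, Module.finrank_pi_fintype,
      Complex.finrank_real_complex, Finset.sum_const, Finset.card_univ, Fintype.card_fin,
      smul_eq_mul]
    omega
  obtain ⟨a, haT, ha0⟩ := (Submodule.ne_bot_iff _).1
    (LinearMap.ker_ne_bot_of_finrank_lt hrank (f := T))
  have haT : ((fderiv ℝ g₁ x a, fderiv ℝ g₁ x (Complex.I • a)),
      (fderiv ℝ g₂ y a, fderiv ℝ g₂ y (Complex.I • a))) = (((0 : ℝ), (0 : ℝ)), ((0 : ℝ), (0 : ℝ))) :=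
    haT
  simp only [Prod.mk.injEq] at haT
  obtain ⟨⟨h1, h2⟩, h3, h4⟩ := haT
  have k1 := second_order_le hg₁ hg₂ h1 h3 hν₁ hν₂ hmax heq
  have k2 := second_order_le hg₁ hg₂ h2 h4 hν₁ hν₂ hmax heq
  rw [rePairing_I_smul] at k2
  have l1 := hl₁ a
  have l2 := hl₂ a
  simp only [leviForm, iteratedFDeriv_two_apply, Matrix.cons_val_zero, Matrix.cons_val_one] at l1 l2
  rw [eq_neg_of_add_eq_zero_right l1, eq_neg_of_add_eq_zero_right l2] at k2
  by_contra! hc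
  have := mul_pos (sub_pos.2 hc) (rePairing_self_pos ha0)
  linarith

/-- The radial projection onto the unit sphere of `rePairing`. -/
def radialProj {m : ℕ} (z : Fin m → ℂ) : Fin m → ℂ := (√(rePairing z z))⁻¹ • z

theorem rePairing_radialProj {m : ℕ} (z w : Fin m → ℂ) :
    rePairing (radialProj z) (radialProj w) =
      (√(rePairing z z))⁻¹ * ((√(rePairing w w))⁻¹ * rePairing z w) := by
  rw [radialProj, radialProj, rePairing_smul_left, rePairing_smul_right]

theorem rePairing_radialProj_self {m : ℕ} {z : Fin m → ℂ} (hz : z ≠ 0) :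
    rePairing (radialProj z) (radialProj z) = 1 := by
  have hpos := rePairing_self_pos hz
  have hs := Real.mul_self_sqrt hpos.le
  have h0 : √(rePairing z z) ≠ 0 := (Real.sqrt_pos.2 hpos).ne'
  rw [rePairing_radialProj]
  field_simp
  rw [pow_two, hs]

theorem radialProj_eq_self {m : ℕ} {z : Fin m → ℂ} (hz : rePairing z z = 1) : radialProj z = z := by
  simp [radialProj, hz]

theorem continuousAt_radialProj {m : ℕ} {z : Fin m → ℂ} (hz : z ≠ 0) :
    ContinuousAt radialProj z := by
  have hcont : Continuous fun z : Fin m → ℂ => rePairing z z :=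
    continuous_rePairing.comp (continuous_id.prodMk continuous_id)
  exact (hcont.sqrt.continuousAt.inv₀ (Real.sqrt_pos.2 (rePairing_self_pos hz)).ne').smul
    continuousAt_id

theorem rePairing_le_of_radialProj_le {m : ℕ} {z w : Fin m → ℂ} (hz : z ≠ 0) (hw : w ≠ 0) {k : ℝ}
    (hk : 0 ≤ k) (h : rePairing (radialProj z) (radialProj w) ≤ k) :
    rePairing z w ≤ k / 2 * (rePairing z z + rePairing w w) := by
  have hzpos := rePairing_self_pos hz
  have hwpos := rePairing_self_pos hw
  have hz2 := Real.sq_sqrt hzpos.le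
  have hw2 := Real.sq_sqrt hwpos.le
  have hz0 := Real.sqrt_pos.2 hzpos
  have hw0 := Real.sqrt_pos.2 hwpos
  rw [rePairing_radialProj] at h
  set r := √(rePairing z z)
  set q := √(rePairing w w)
  have h1 : rePairing z w = r * q * (r⁻¹ * (q⁻¹ * rePairing z w)) := by field_simp
  have h2 := mul_le_mul_of_nonneg_left h (mul_pos hz0 hw0).le
  rw [← h1] at h2
  rw [← hz2, ← hw2]
  nlinarith [mul_nonneg hk (sq_nonneg (r - q))]

/-- No closed smooth Levi-flat hypersurface of `ℂℙⁿ`, `n ≥ 2`, is globally defined by a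
pluriharmonic function on a neighbourhood. -/
theorem leviFlat_in_CPn_has_no_global_pluriharmonic_defining_function
    (n : ℕ) (hn : 2 ≤ n)
    (M : Set (Fin (n + 1) → ℂ)) (hM : IsProjectiveClosedSet M)
    (hLF : IsSmoothLeviFlatHypersurface M) :
    ¬ ∃ W : Set (Fin (n + 1) → ℂ), ∃ ρ : (Fin (n + 1) → ℂ) → ℝ,
        IsOpen W ∧ M ⊆ W ∧ (∀ z ∈ W, z ≠ 0) ∧
        (∀ c : ℂ, c ≠ 0 → ∀ z ∈ W, c • z ∈ W ∧ ρ (c • z) = ρ z) ∧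
        ContDiffOn ℝ 2 ρ W ∧
        (∀ z ∈ W, ∀ w : Fin (n + 1) → ℂ, leviForm ρ z w = 0) ∧
        (∀ z ∈ W, fderiv ℝ ρ z ≠ 0) ∧
        M = {z ∈ W | ρ z = 0} := by
  rintro ⟨W, ρ, hWo, hMW, hW0, hcone, hC2, hlevi, hgrad, hMeq⟩
  obtain ⟨⟨p₀, hp₀⟩, hM0, hMcone, hMcl⟩ := hM
  have hscale : ∀ z ∈ W, radialProj z ∈ W ∧ ρ (radialProj z) = ρ z := by
    intro z hz
    have h0 : (((√(rePairing z z))⁻¹ : ℝ) : ℂ) ≠ 0 := by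
      simpa using (Real.sqrt_pos.2 (rePairing_self_pos (hW0 z hz))).ne'
    have hcz := hcone _ h0 z hz
    rwa [Complex.coe_smul] at hcz
  have hMiff : ∀ z ∈ W, z ∈ M ↔ ρ z = 0 := fun z hz => by rw [hMeq]; simp [hz]
  have hMproj : ∀ z ∈ M, radialProj z ∈ M := fun z hz => by
    obtain ⟨h1, h2⟩ := hscale z (hMW hz)
    rw [hMiff _ h1, h2, ← hMiff z (hMW hz)]
    exact hz
  have hcont : ContinuousOn ρ W := hC2.continuousOn
  have hsphere : IsCompact {z : Fin (n + 1) → ℂ | rePairing z z = 1} := isCompact_rePairing_sphere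
  set S := {z : Fin (n + 1) → ℂ | rePairing z z = 1}
  have hS0 : ∀ z ∈ S, z ≠ 0 := fun z hz h => by
    have : rePairing z z = 0 := rePairing_self_eq_zero.2 h
    exact zero_ne_one (this.symm.trans hz)
  have hM₁ : IsCompact (M ∩ S) := by
    have : M ∩ S = S ∩ closure M := by
      ext z
      exact ⟨fun h => ⟨h.2, subset_closure h.1⟩, fun h => ⟨hMcl z h.2 (hS0 z h.1), h.1⟩⟩
    rw [this]
    exact hsphere.inter_right isClosed_closure
  obtain ⟨K, hK, hMK, hKW⟩ := exists_compact_between hM₁ hWo (inter_subset_left.trans hMW)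
  have hKS : IsCompact (K ∩ S) := hK.inter_right hsphere.isClosed
  obtain ⟨δ, hδ, hδle⟩ : ∃ δ, 0 < δ ∧ ∀ z ∈ (K ∩ S) \ interior K, δ ≤ |ρ z| := by
    refine (hKS.diff isOpen_interior).exists_forall_le'
      (hcont.abs.mono fun z hz => hKW hz.1.1) fun z hz => abs_pos.2 fun h => hz.2 (hMK ?_)
    exact ⟨(hMiff z (hKW hz.1.1)).2 h, hz.1.2⟩
  set p := radialProj p₀
  have hpM : p ∈ M := hMproj _ hp₀
  have hpS : p ∈ S := rePairing_radialProj_self (hM0 _ hp₀)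
  obtain ⟨v, ⟨hvK, hvS⟩, hv0, hvδ⟩ : ∃ v ∈ K ∩ S, ρ v ≠ 0 ∧ |ρ v| < δ := by
    have hpW := hMW hpM
    have hρp : ρ p = 0 := (hMiff p hpW).1 hpM
    have h1 : ∃ᶠ w in 𝓝 p, ρ w ≠ 0 := by
      intro h
      refine hgrad p hpW ?_
      have : ρ =ᶠ[𝓝 p] fun _ => 0 := by
        filter_upwards [h] with w hw
        simpa using hw
      rw [this.fderiv_eq]
      simp
    have h2 : ∀ᶠ w in 𝓝 p, radialProj w ∈ interior K := by
      refine (continuousAt_radialProj (hM0 p hpM)).eventually (isOpen_interior.mem_nhds ?_)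
      rw [radialProj_eq_self hpS]
      exact hMK ⟨hpM, hpS⟩
    have h3 : ∀ᶠ w in 𝓝 p, |ρ w| < δ := by
      refine (hcont.continuousAt (hWo.mem_nhds hpW)).abs.eventually (eventually_lt_nhds ?_)
      simpa [hρp] using hδ
    obtain ⟨w, hw1, hw2, hw3, hw4⟩ :=
      (h1.and_eventually (h2.and (h3.and (hWo.mem_nhds hpW)))).exists
    obtain ⟨-, h⟩ := hscale w hw4
    exact ⟨radialProj w, ⟨interior_subset hw2, rePairing_radialProj_self (hW0 w hw4)⟩,
      h ▸ hw1, h ▸ hw3⟩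
  set N := (K ∩ S) ∩ ρ ⁻¹' {ρ v}
  have hN : IsCompact N := hKS.of_isClosed_subset
    ((hcont.mono (inter_subset_left.trans hKW)).preimage_isClosed_of_isClosed hKS.isClosed
      isClosed_singleton) inter_subset_left
  obtain ⟨⟨x, y⟩, ⟨hx, hy⟩, hxy⟩ := (hM₁.prod hN).exists_isMaxOn
    ⟨(p, v), ⟨hpM, hpS⟩, ⟨hvK, hvS⟩, rfl⟩ continuous_rePairing.continuousOn
  have hxy : ∀ z ∈ M ∩ S, ∀ w ∈ N, rePairing z w ≤ rePairing x y :=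
    fun z hz w hw => hxy (show (z, w) ∈ (M ∩ S) ×ˢ N from ⟨hz, hw⟩)
  have hxW := hMW hx.1
  have hyW := hKW hy.1.1
  have hρx : ρ x = 0 := (hMiff x hxW).1 hx.1
  have hρy : ρ y = ρ v := hy.2
  have hyint : y ∈ interior K := by
    by_contra h
    have := hδle y ⟨hy.1, h⟩
    rw [hρy] at this
    linarith
  have hxx : rePairing x x = 1 := hx.2
  have hyy : rePairing y y = 1 := hy.1.2
  have hneg : ∀ z w : Fin (n + 1) → ℂ, rePairing (-z) w = -rePairing z w := fun z w => by
    simpa using rePairing_smul_left (-1) z w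
  have hnonneg : 0 ≤ rePairing x y := by
    have h1 : -x ∈ M := by simpa using hMcone (-1) (by simp) x hx.1
    have h2 : -x ∈ S := by
      change rePairing (-x) (-x) = 1
      rw [hneg, rePairing_comm, hneg, neg_neg, hxx]
    have h3 := hxy (-x) ⟨h1, h2⟩ y hy
    rw [hneg] at h3
    linarith
  have hlt : rePairing x y < 1 := by
    have hne : x + -y ≠ 0 := fun h => by
      rw [← eq_neg_iff_add_eq_zero, neg_neg] at h
      exact hv0 (by rw [← hρy, ← h, hρx])
    have := rePairing_self_pos hne
    simp only [rePairing_add_left, rePairing_add_right, hneg, rePairing_comm _ (-y), hxx,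
      hyy] at this
    rw [rePairing_comm y x] at this
    linarith
  have hmax : ∀ᶠ q in 𝓝 (x, y), ρ q.1 = ρ x → ρ q.2 = ρ y →
      rePairing q.1 q.2 ≤ rePairing x y / 2 * (rePairing q.1 q.1 + rePairing q.2 q.2) := by
    have h1 : ∀ᶠ q in 𝓝 (x, y), q.1 ∈ W := continuousAt_fst.eventually (hWo.mem_nhds hxW)
    have h2 : ∀ᶠ q in 𝓝 (x, y), q.2 ∈ W := continuousAt_snd.eventually (hWo.mem_nhds hyW)
    have h3 : ∀ᶠ w in 𝓝 y, radialProj w ∈ interior K := by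
      refine (continuousAt_radialProj (hW0 y hyW)).eventually (isOpen_interior.mem_nhds ?_)
      rwa [radialProj_eq_self hyy]
    have h4 : ∀ᶠ q in 𝓝 (x, y), radialProj q.2 ∈ interior K :=
      (continuous_snd.tendsto (x, y)).eventually h3
    filter_upwards [h1, h2, h4] with q hq1 hq2 hq4 hqx hqy
    refine rePairing_le_of_radialProj_le (hW0 _ hq1) (hW0 _ hq2) hnonneg
      (hxy _ ⟨?_, ?_⟩ _ ⟨⟨?_, ?_⟩, ?_⟩)
    · exact hMproj _ ((hMiff _ hq1).2 (hqx.trans hρx))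
    · exact rePairing_radialProj_self (hW0 _ hq1)
    · exact interior_subset hq4
    · exact rePairing_radialProj_self (hW0 _ hq2)
    · exact (hscale _ hq2).2.trans (hqy.trans hρy)
  have := half_le_of_leviForm_eq_zero hn (hC2.contDiffAt (hWo.mem_nhds hxW))
    (hC2.contDiffAt (hWo.mem_nhds hyW)) (hgrad x hxW) (hgrad y hyW) (hlevi x hxW) (hlevi y hyW)
    hmax (by rw [hxx, hyy]; ring)
  linarith
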